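/- arXiv:1412.0883 — 7 statements merged into one kernel-verified Lean document; each statement's English description precedes it below -/
import Mathlib

section
/- For every real number a > 0, the integral ∫₀^∞ ((a·u + 1)·e^{-a·u})/(u + 1) du equals 1 + (1 - a)·e^{a}·∫_a^∞ (e^{-t}/t) dt. -/
open MeasureTheory Real Set

/-- The substitution `t = a (u + 1)` in the exponential integral. -/
theorem integral_exp_neg_mul_div_add_one (a : ℝ) (ha : 0 < a) :
    ∫ u in Ioi (0 : ℝ), exp (-(a * u)) / (u + 1)
      = exp a * ∫ t in Ioi a, exp (-t) / t := by
  have hshift := (measurePreserving_add_right volume (1 : ℝ)).setIntegral_preimage_emb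
    (measurableEmbedding_addRight (1 : ℝ)) (fun v => exp (-(a * v)) / (a * v)) (Ioi 1)
  have hscale := integral_comp_mul_left_Ioi' (fun t => exp (-t) / t) 1 ha
  simp only [preimage_add_const_Ioi, sub_self, mul_one, smul_eq_mul] at hshift hscale
  rw [← hscale, ← hshift, ← integral_const_mul, ← integral_const_mul]
  refine setIntegral_congr_fun measurableSet_Ioi fun u hu => ?_
  have hu1 : u + 1 ≠ 0 := by linarith [mem_Ioi.mp hu]
  have hexp : exp (-(a * u)) = exp a * exp (-(a * (u + 1))) := by
    rw [← exp_add]; ring_nf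
  simp only [hexp]
  field_simp

theorem integrableOn_exp_neg_mul_div_add_one (a : ℝ) (ha : 0 < a) :
    IntegrableOn (fun u => exp (-(a * u)) / (u + 1)) (Ioi (0 : ℝ)) := by
  have hexp := exp_neg_integrableOn_Ioi 0 ha
  refine hexp.mono' (Measurable.aestronglyMeasurable (by fun_prop)) ?_
  filter_upwards [ae_restrict_mem measurableSet_Ioi] with u hu
  have hu0 : 0 < u := hu
  rw [norm_of_nonneg (by positivity), neg_mul]
  exact div_le_self (exp_pos _).le (by linarith)

/-- For every real `a > 0`,
`∫₀^∞ ((a·u + 1)·e^{-a·u})/(u + 1) du = 1 + (1 - a)·e^{a}·∫_a^∞ (e^{-t}/t) dt`. -/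
theorem integral_rus_su_rate (a : ℝ) (ha : 0 < a) :
    ∫ u in Set.Ioi (0 : ℝ), ((a * u + 1) * Real.exp (-(a * u))) / (u + 1)
      = 1 + (1 - a) * Real.exp a * ∫ t in Set.Ioi a, Real.exp (-t) / t := by
  have hint : IntegrableOn (fun u => exp (-a * u)) (Ioi (0 : ℝ)) :=
    exp_neg_integrableOn_Ioi 0 ha
  have hexp : ∫ u in Ioi (0 : ℝ), a * exp (-a * u) = 1 := by
    rw [integral_const_mul, integral_exp_mul_Ioi (neg_lt_zero.mpr ha)]
    simp [ha.ne']
  have hsum := integral_add (hint.const_mul a)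
    ((integrableOn_exp_neg_mul_div_add_one a ha).const_mul (1 - a))
  rw [hexp, integral_const_mul, integral_exp_neg_mul_div_add_one a ha, ← mul_assoc] at hsum
  rw [← hsum]
  refine setIntegral_congr_fun measurableSet_Ioi fun u hu => ?_
  have hu1 : u + 1 ≠ 0 := by linarith [mem_Ioi.mp hu]
  simp only [neg_mul]
  field_simp
  ring
end

section
/- Let a > 0 and let S be a real random variable that is Gamma(2,a)-distributed. Then E[log(1 + S)] = 1 + (1 - a)·e^{a}·∫_a^∞ (e^{-t}/t) dt. -/
open MeasureTheory Real Set

/-- The Gamma(2, a) law: density `a² · x · e^{-a·x}` on `(0, ∞)` (shape 2, rate `a`). -/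
noncomputable def gammaLaw (a : ℝ) : Measure ℝ :=
  volume.withDensity fun x =>
    ENNReal.ofReal (if 0 < x then a ^ 2 * x * Real.exp (-(a * x)) else 0)

open Filter Topology

lemma integral_gammaLaw {a : ℝ} (g : ℝ → ℝ) :
    ∫ x, g x ∂(gammaLaw a) = ∫ x in Ioi 0, a ^ 2 * x * exp (-(a * x)) * g x := by
  rw [gammaLaw, integral_withDensity_eq_integral_toReal_smul, ← integral_indicator measurableSet_Ioi]
  · congr 1 with x
    by_cases hx : 0 < x
    · rw [if_pos hx, indicator_of_mem (mem_Ioi.mpr hx), ENNReal.toReal_ofReal (by positivity),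
        smul_eq_mul]
    · rw [if_neg hx, indicator_of_notMem (by simpa using hx)]
      simp
  · exact (Measurable.ite measurableSet_Ioi (by fun_prop) measurable_const).ennreal_ofReal
  · exact ae_of_all _ fun _ => ENNReal.ofReal_lt_top

lemma integral_exp_neg_mul_div_one_add {a : ℝ} (ha : 0 < a) :
    ∫ x in Ioi 0, exp (-(a * x)) / (1 + x) = exp a * ∫ t in Ioi a, exp (-t) / t := by
  have hscale := integral_comp_mul_left_Ioi' (fun t : ℝ => exp (-t) / t) 1 ha
  have hshift := (measurePreserving_add_right volume (1 : ℝ)).setIntegral_preimage_emb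
    (measurableEmbedding_addRight 1) (fun x : ℝ => exp (-(a * x)) / (a * x)) (Ioi 1)
  rw [preimage_add_const_Ioi, sub_self] at hshift
  rw [mul_one] at hscale
  rw [← hscale, ← hshift, smul_eq_mul, ← integral_const_mul, ← integral_const_mul]
  refine setIntegral_congr_fun measurableSet_Ioi fun x (hx : 0 < x) => ?_
  have hexp : exp (-(a * x)) = exp a * exp (-(a * (x + 1))) := by
    rw [← exp_add]
    ring_nf
  rw [hexp]
  field_simp
  ring

lemma integrableOn_exp_neg_mul_div_one_add {a : ℝ} (ha : 0 < a) :
    IntegrableOn (fun x : ℝ => exp (-(a * x)) / (1 + x)) (Ioi 0) := by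
  refine Integrable.mono' (exp_neg_integrableOn_Ioi 0 ha)
    (Measurable.aestronglyMeasurable (by fun_prop)) ?_
  filter_upwards [ae_restrict_mem measurableSet_Ioi] with x (hx : 0 < x)
  rw [norm_of_nonneg (by positivity), neg_mul]
  exact div_le_self (exp_nonneg _) (by linarith)

lemma log_one_add_le_self {x : ℝ} (hx : 0 ≤ x) : log (1 + x) ≤ x := by
  linarith [log_le_sub_one_of_pos (show 0 < 1 + x by linarith)]

lemma integrableOn_gamma_density_mul_log_one_add {a : ℝ} (ha : 0 < a) :
    IntegrableOn (fun x : ℝ => a ^ 2 * x * exp (-(a * x)) * log (1 + x)) (Ioi 0) := by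
  have hdom := (integrableOn_rpow_mul_exp_neg_mul_rpow (p := 1) (s := 2) (by norm_num)
    one_pos ha).const_mul (a ^ 2)
  refine Integrable.mono' hdom (Measurable.aestronglyMeasurable (by fun_prop)) ?_
  filter_upwards [ae_restrict_mem measurableSet_Ioi] with x (hx : 0 < x)
  have hlog : 0 ≤ log (1 + x) := log_nonneg (by linarith)
  rw [norm_of_nonneg (by positivity), rpow_two, rpow_one, neg_mul]
  calc a ^ 2 * x * exp (-(a * x)) * log (1 + x)
      ≤ a ^ 2 * x * exp (-(a * x)) * x := by
        gcongr
        exact log_one_add_le_self hx.le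
    _ = a ^ 2 * (x ^ 2 * exp (-(a * x))) := by ring

lemma tendsto_one_add_mul_exp_neg_mul_log_one_add {a : ℝ} (ha : 0 < a) :
    Tendsto (fun x : ℝ => (1 + a * x) * exp (-(a * x)) * log (1 + x)) atTop (𝓝 0) := by
  have hlin : Tendsto (fun x : ℝ => a * x) atTop atTop := tendsto_id.const_mul_atTop ha
  have hbound : Tendsto (fun y : ℝ => a⁻¹ * (y ^ 1 * exp (-y) + y ^ 2 * exp (-y))) atTop (𝓝 0) := by
    simpa using ((tendsto_pow_mul_exp_neg_atTop_nhds_zero 1).add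
      (tendsto_pow_mul_exp_neg_atTop_nhds_zero 2)).const_mul a⁻¹
  refine squeeze_zero' ?_ ?_ (hbound.comp hlin)
  · filter_upwards [eventually_ge_atTop 0] with x hx
    have hlog : 0 ≤ log (1 + x) := log_nonneg (by linarith)
    positivity
  · filter_upwards [eventually_ge_atTop 0] with x hx
    calc (1 + a * x) * exp (-(a * x)) * log (1 + x)
        ≤ (1 + a * x) * exp (-(a * x)) * x := by
          gcongr
          exact log_one_add_le_self hx
      _ = a⁻¹ * ((a * x) ^ 1 * exp (-(a * x)) + (a * x) ^ 2 * exp (-(a * x))) := by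
          field_simp

lemma hasDerivAt_gamma_log_antideriv (a : ℝ) {x : ℝ} (hx : 0 ≤ x) :
    HasDerivAt (fun x : ℝ => -((1 + a * x) * exp (-(a * x)) * log (1 + x)) - exp (-(a * x)))
      (a ^ 2 * x * exp (-(a * x)) * log (1 + x) - (1 - a) * (exp (-(a * x)) / (1 + x))) x := by
  have hne : 1 + x ≠ 0 := by positivity
  have hlin : HasDerivAt (fun x : ℝ => a * x) a x := by
    simpa using (hasDerivAt_id x).const_mul a
  have hexp := hlin.neg.exp
  have hlog := ((hasDerivAt_id x).const_add 1).log hne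
  refine ((((hlin.const_add 1).mul hexp).mul hlog).neg.sub hexp).congr_deriv ?_
  simp only [Pi.mul_apply, Pi.neg_apply, id]
  field_simp
  ring

lemma integral_gamma_density_mul_log_one_add {a : ℝ} (ha : 0 < a) :
    ∫ x in Ioi 0, a ^ 2 * x * exp (-(a * x)) * log (1 + x)
      = 1 + (1 - a) * ∫ x in Ioi 0, exp (-(a * x)) / (1 + x) := by
  have hf := integrableOn_gamma_density_mul_log_one_add ha
  have hg := (integrableOn_exp_neg_mul_div_one_add ha).const_mul (1 - a)
  have hlim : Tendsto (fun x : ℝ => -((1 + a * x) * exp (-(a * x)) * log (1 + x))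
      - exp (-(a * x))) atTop (𝓝 0) := by
    simpa using (tendsto_one_add_mul_exp_neg_mul_log_one_add ha).neg.sub
      (tendsto_exp_neg_atTop_nhds_zero.comp (tendsto_id.const_mul_atTop ha))
  have hftc := integral_Ioi_of_hasDerivAt_of_tendsto'
    (fun x hx => hasDerivAt_gamma_log_antideriv a hx) (hf.sub hg) hlim
  rw [integral_sub hf hg, integral_const_mul] at hftc
  simp only [mul_zero, add_zero, log_one, neg_zero, exp_zero] at hftc
  linarith

/-- If `a > 0` and `S` is Gamma(2,a)-distributed, then
`E[log(1 + S)] = 1 + (1 - a)·e^{a}·∫_a^∞ (e^{-t}/t) dt`. -/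
theorem expectation_log_one_add_gamma {Ω : Type*} [MeasurableSpace Ω]
    (μ : Measure Ω) [IsProbabilityMeasure μ]
    (a : ℝ) (ha : 0 < a) (S : Ω → ℝ) (hS : Measurable S)
    (hlaw : Measure.map S μ = gammaLaw a) :
    ∫ ω, Real.log (1 + S ω) ∂μ
      = 1 + (1 - a) * Real.exp a * ∫ t in Set.Ioi a, Real.exp (-t) / t := by
  have hmeas : Measurable fun x : ℝ => log (1 + x) := by fun_prop
  rw [← integral_map hS.aemeasurable hmeas.aestronglyMeasurable, hlaw, integral_gammaLaw,
    integral_gamma_density_mul_log_one_add ha, integral_exp_neg_mul_div_one_add ha, mul_assoc]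
end

section
/- Let a > 0 and α ∈ (0,1). Let S be Gamma(2,a)-distributed and Y be uniformly distributed on [0, α²], with S and Y independent. Then the random variable W = (S^{-1} + Y)^{-1} has a law with density f_W(x) = (1/(α²·x²))·[Γ(2, a·x) - Γ(2, a/(x^{-1} - α²))] for 0 < x < 1/α², and f_W(x) = (1/(α²·x²))·Γ(2, a·x) for x ≥ 1/α². -/
open MeasureTheory Real Set
open scoped ENNReal

/-- The uniform law on the real interval `[lo, hi]`. -/
noncomputable def unifLaw (lo hi : ℝ) : Measure ℝ :=
  (ENNReal.ofReal (hi - lo))⁻¹ • volume.restrict (Set.Icc lo hi)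

/-- The upper incomplete gamma function with shape 2: `Γ(2, z) = (1 + z)·e^{-z}`. -/
noncomputable def uGamma2 (z : ℝ) : ℝ := (1 + z) * Real.exp (-z)

lemma gammaLaw_Iic_zero (a : ℝ) : gammaLaw a (Iic 0) = 0 := by
  rw [gammaLaw, withDensity_apply _ measurableSet_Iic, setLIntegral_congr_fun measurableSet_Iic
    (g := fun _ => 0)]
  · simp
  · intro x hx
    simp [not_lt.2 (mem_Iic.1 hx)]

lemma hasDerivAt_neg_uGamma2 (a x : ℝ) :
    HasDerivAt (fun s => -uGamma2 (a * s)) (a ^ 2 * x * Real.exp (-(a * x))) x := by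
  have h₁ : HasDerivAt (fun s : ℝ => a * s) a x := by
    simpa using (hasDerivAt_id x).const_mul a
  have h₂ := ((h₁.const_add 1).mul h₁.neg.exp).neg
  refine h₂.congr_deriv ?_
  simp only [Pi.neg_apply]
  ring

lemma tendsto_neg_uGamma2_atTop {a : ℝ} (ha : 0 < a) :
    Filter.Tendsto (fun s => -uGamma2 (a * s)) Filter.atTop (nhds 0) := by
  have h₀ : Filter.Tendsto (fun z => -uGamma2 z) Filter.atTop (nhds 0) := by
    have h₁ := Real.tendsto_pow_mul_exp_neg_atTop_nhds_zero 1
    have h₂ := Real.tendsto_pow_mul_exp_neg_atTop_nhds_zero 0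
    simpa [uGamma2, add_mul] using (h₂.add h₁).neg
  exact h₀.comp (Filter.tendsto_id.const_mul_atTop ha)

lemma gammaLaw_Ioi {a x : ℝ} (ha : 0 < a) (hx : 0 < x) :
    gammaLaw a (Ioi x) = ENNReal.ofReal (uGamma2 (a * x)) := by
  have hpos : ∀ s ∈ Ioi x, 0 ≤ a ^ 2 * s * Real.exp (-(a * s)) := fun s hs => by
    have : 0 < s := hx.trans hs
    positivity
  have hd : ∀ s ∈ Ici x, HasDerivAt (fun s => -uGamma2 (a * s))
      (a ^ 2 * s * Real.exp (-(a * s))) s := fun s _ => hasDerivAt_neg_uGamma2 a s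
  have hint := integrableOn_Ioi_deriv_of_nonneg' hd hpos (tendsto_neg_uGamma2_atTop ha)
  have hval := integral_Ioi_of_hasDerivAt_of_nonneg' hd hpos (tendsto_neg_uGamma2_atTop ha)
  rw [gammaLaw, withDensity_apply _ measurableSet_Ioi, setLIntegral_congr_fun measurableSet_Ioi
    (g := fun s => ENNReal.ofReal (a ^ 2 * s * Real.exp (-(a * s)))),
    ← ofReal_integral_eq_lintegral_ofReal hint, hval]
  · simp
  · exact (ae_restrict_iff' measurableSet_Ioi).2 (Filter.Eventually.of_forall hpos)
  · intro s hs
    simp [hx.trans (mem_Ioi.1 hs)]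

lemma gammaLaw_Ici {a x : ℝ} (ha : 0 < a) (hx : 0 < x) :
    gammaLaw a (Ici x) = ENNReal.ofReal (uGamma2 (a * x)) := by
  rw [← gammaLaw_Ioi ha hx]
  exact (withDensity_absolutelyContinuous _ _).ae_eq Ioi_ae_eq_Ici.symm |> measure_congr

lemma uGamma2_nonneg {z : ℝ} (hz : 0 ≤ z) : 0 ≤ uGamma2 z := by
  unfold uGamma2
  positivity

lemma gammaLaw_Icc {a x y : ℝ} (ha : 0 < a) (hx : 0 < x) (hxy : x ≤ y) :
    gammaLaw a (Icc x y) = ENNReal.ofReal (uGamma2 (a * x) - uGamma2 (a * y)) := by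
  have hy : 0 < y := hx.trans_le hxy
  have h : Icc x y = Ici x \ Ioi y := by
    ext s
    simp
  rw [h, measure_sdiff (Ioi_subset_Ici hxy) measurableSet_Ioi.nullMeasurableSet,
    gammaLaw_Ici ha hx, gammaLaw_Ioi ha hy, ENNReal.ofReal_sub _ (uGamma2_nonneg (by positivity))]
  simp [gammaLaw_Ioi ha hy]

lemma gammaLaw_inter_Ioi_zero (a : ℝ) (s : Set ℝ) :
    gammaLaw a (s ∩ Ioi 0) = gammaLaw a s := by
  refine measure_inter_conull ?_
  rw [compl_Ioi]
  exact gammaLaw_Iic_zero a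

lemma gammaLaw_sub_inv_of_nonpos {a v b : ℝ} (hv : v ≤ 0) :
    gammaLaw a {s | v - s⁻¹ ∈ Icc 0 b} = 0 := by
  rw [← gammaLaw_inter_Ioi_zero]
  convert measure_empty (μ := gammaLaw a)
  ext s
  simp only [mem_inter_iff, mem_ofPred_eq, mem_Icc, mem_Ioi, mem_empty_iff_false, iff_false]
  rintro ⟨⟨h, -⟩, hs⟩
  have := inv_pos.2 hs
  linarith

lemma gammaLaw_inv_sub_inv_of_lt {a x b : ℝ} (ha : 0 < a) (hx : 0 < x) (hb : 0 < b)
    (hxb : x < 1 / b) :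
    gammaLaw a {s | x⁻¹ - s⁻¹ ∈ Icc 0 b} =
      ENNReal.ofReal (uGamma2 (a * x) - uGamma2 (a / (x⁻¹ - b))) := by
  have hpos : 0 < x⁻¹ - b := by
    rw [one_div] at hxb
    have := (lt_inv_comm₀ hx hb).1 hxb
    linarith
  have hxy : x ≤ (x⁻¹ - b)⁻¹ := by
    rw [le_inv_comm₀ hx hpos]
    linarith
  rw [div_eq_mul_inv, ← gammaLaw_Icc ha hx hxy, ← gammaLaw_inter_Ioi_zero,
    ← gammaLaw_inter_Ioi_zero a (Icc _ _)]
  congr 1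
  ext s
  simp only [mem_inter_iff, mem_ofPred_eq, mem_Icc, mem_Ioi]
  refine and_congr_left fun hs => and_congr ?_ ?_
  · rw [sub_nonneg, inv_le_inv₀ hs hx]
  · rw [le_inv_comm₀ hs hpos, sub_le_comm]

lemma gammaLaw_inv_sub_inv_of_le {a x b : ℝ} (ha : 0 < a) (hx : 0 < x) (hb : 0 < b)
    (hxb : 1 / b ≤ x) :
    gammaLaw a {s | x⁻¹ - s⁻¹ ∈ Icc 0 b} = ENNReal.ofReal (uGamma2 (a * x)) := by
  have hle : x⁻¹ ≤ b := by
    rw [one_div] at hxb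
    exact (inv_le_comm₀ hb hx).1 hxb
  rw [← gammaLaw_Ici ha hx, ← gammaLaw_inter_Ioi_zero, ← gammaLaw_inter_Ioi_zero a (Ici _)]
  congr 1
  ext s
  simp only [mem_inter_iff, mem_ofPred_eq, mem_Icc, mem_Ioi, mem_Ici]
  refine and_congr_left fun hs => ?_
  rw [sub_nonneg, inv_le_inv₀ hs hx, and_iff_left]
  have := inv_pos.2 hs
  linarith

lemma lintegral_Ioi_zero_eq_lintegral_inv (g : ℝ → ℝ≥0∞) :
    ∫⁻ v in Ioi 0, g v = ∫⁻ x in Ioi 0, ENNReal.ofReal (1 / x ^ 2) * g x⁻¹ := by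
  have himage : (fun x : ℝ => x⁻¹) '' Ioi 0 = Ioi 0 := by
    ext x
    simp
  have h := lintegral_image_eq_lintegral_abs_deriv_mul measurableSet_Ioi
    (fun x (hx : x ∈ Ioi (0 : ℝ)) => (hasDerivAt_inv (ne_of_gt hx)).hasDerivWithinAt)
    inv_injective.injOn g
  rw [himage] at h
  rw [h]
  simp

/-- Tonelli after the substitution `v = s⁻¹ + y`. -/
lemma lintegral_lintegral_inv_add (ν : Measure ℝ) [SFinite ν] (b : ℝ) {f : ℝ → ℝ≥0∞}
    (hf : Measurable f) :
    ∫⁻ s, (∫⁻ y in Icc 0 b, f (s⁻¹ + y)⁻¹) ∂ν =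
      ∫⁻ v, f v⁻¹ * ν {s | v - s⁻¹ ∈ Icc 0 b} := by
  have hinner : ∀ s : ℝ, ∫⁻ y in Icc 0 b, f (s⁻¹ + y)⁻¹ =
      ∫⁻ v, f v⁻¹ * {p : ℝ × ℝ | p.2 - p.1⁻¹ ∈ Icc 0 b}.indicator 1 (s, v) := fun s => by
    rw [← lintegral_indicator measurableSet_Icc,
      ← lintegral_sub_right_eq_self _ s⁻¹]
    refine lintegral_congr fun v => ?_
    by_cases h : v - s⁻¹ ∈ Icc 0 b
    · rw [indicator_of_mem h, indicator_of_mem (by exact h)]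
      simp
    · rw [indicator_of_notMem h, indicator_of_notMem (by exact h)]
      simp
  have hmeas : MeasurableSet {p : ℝ × ℝ | p.2 - p.1⁻¹ ∈ Icc 0 b} :=
    (measurable_snd.sub measurable_fst.inv) measurableSet_Icc
  simp_rw [hinner]
  rw [lintegral_lintegral_swap]
  · refine lintegral_congr fun v => ?_
    have hsec : Measurable fun s : ℝ =>
        {p : ℝ × ℝ | p.2 - p.1⁻¹ ∈ Icc 0 b}.indicator (1 : ℝ × ℝ → ℝ≥0∞) (s, v) :=
      (measurable_one.indicator hmeas).comp measurable_prodMk_right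
    have hv : MeasurableSet {s : ℝ | v - s⁻¹ ∈ Icc 0 b} :=
      (measurable_const.sub measurable_inv) measurableSet_Icc
    rw [lintegral_const_mul _ hsec, ← lintegral_indicator_one hv]
    rfl
  · exact ((hf.comp measurable_snd.inv).mul (measurable_one.indicator hmeas)).aemeasurable

/-- SINR density under maximum-ratio transmission: if `S ~ Gamma(2,a)`,
`Y ~ Uniform[0, α²]` are independent, then `W = (S⁻¹ + Y)⁻¹` has law with density
`(1/(α²x²))·[Γ(2, a·x) - Γ(2, a/(x⁻¹ - α²))]` for `0 < x < 1/α²` and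
`(1/(α²x²))·Γ(2, a·x)` for `x ≥ 1/α²` (and `0` for `x ≤ 0`, since `W > 0` a.s.). -/
theorem mrt_sinr_density {Ω : Type*} [MeasurableSpace Ω]
    (μ : Measure Ω) [IsProbabilityMeasure μ]
    (a α : ℝ) (ha : 0 < a) (hα : α ∈ Set.Ioo (0 : ℝ) 1)
    (S Y : Ω → ℝ) (hS : Measurable S) (hY : Measurable Y)
    (hSlaw : Measure.map S μ = gammaLaw a)
    (hYlaw : Measure.map Y μ = unifLaw 0 (α ^ 2))
    (hindep : ProbabilityTheory.IndepFun S Y μ) :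
    Measure.map (fun ω => ((S ω)⁻¹ + Y ω)⁻¹) μ
      = volume.withDensity fun x => ENNReal.ofReal (
          if x ≤ 0 then 0
          else if x < 1 / α ^ 2 then
            (1 / (α ^ 2 * x ^ 2)) * (uGamma2 (a * x) - uGamma2 (a / (x⁻¹ - α ^ 2)))
          else (1 / (α ^ 2 * x ^ 2)) * uGamma2 (a * x)) := by
  have hb : 0 < α ^ 2 := pow_pos hα.1 2
  have : IsProbabilityMeasure (gammaLaw a) :=
    hSlaw ▸ Measure.isProbabilityMeasure_map hS.aemeasurable
  have : IsProbabilityMeasure (unifLaw 0 (α ^ 2)) :=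
    hYlaw ▸ Measure.isProbabilityMeasure_map hY.aemeasurable
  have hjoint : Measure.map (fun ω => (S ω, Y ω)) μ = (gammaLaw a).prod (unifLaw 0 (α ^ 2)) := by
    rw [(ProbabilityTheory.indepFun_iff_map_prod_eq_prod_map_map hS.aemeasurable
      hY.aemeasurable).1 hindep, hSlaw, hYlaw]
  have hW : Measurable fun p : ℝ × ℝ => (p.1⁻¹ + p.2)⁻¹ := by fun_prop
  have hmap : Measure.map (fun ω => ((S ω)⁻¹ + Y ω)⁻¹) μ =
      Measure.map (fun p : ℝ × ℝ => (p.1⁻¹ + p.2)⁻¹)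
        ((gammaLaw a).prod (unifLaw 0 (α ^ 2))) := by
    rw [← hjoint, Measure.map_map hW (hS.prodMk hY)]
    rfl
  ext B hB
  have hf : Measurable (B.indicator (1 : ℝ → ℝ≥0∞)) := measurable_one.indicator hB
  have hc : (ENNReal.ofReal (α ^ 2))⁻¹ ≠ ∞ := by simpa using hα.1.ne'
  have hsupp : ∫⁻ v : ℝ, B.indicator 1 v⁻¹ * gammaLaw a {s | v - s⁻¹ ∈ Icc 0 (α ^ 2)} =
      ∫⁻ v in Ioi (0 : ℝ), B.indicator 1 v⁻¹ * gammaLaw a {s | v - s⁻¹ ∈ Icc 0 (α ^ 2)} := by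
    rw [← lintegral_indicator measurableSet_Ioi]
    refine lintegral_congr fun v => ?_
    rcases lt_or_ge 0 v with hv | hv
    · rw [indicator_of_mem (mem_Ioi.2 hv)]
    · rw [indicator_of_notMem (s := Ioi 0) (by simpa using hv), gammaLaw_sub_inv_of_nonpos hv, mul_zero]
  rw [hmap, ← lintegral_indicator_one hB, lintegral_map hf hW,
    lintegral_prod (fun p : ℝ × ℝ => B.indicator 1 (p.1⁻¹ + p.2)⁻¹) (hf.comp hW).aemeasurable]
  simp only [unifLaw, lintegral_smul_measure, smul_eq_mul, sub_zero]
  rw [lintegral_const_mul' _ _ hc, lintegral_lintegral_inv_add _ _ hf, hsupp,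
    lintegral_Ioi_zero_eq_lintegral_inv, ← lintegral_const_mul' _ _ hc, withDensity_apply _ hB,
    ← lintegral_indicator hB, ← lintegral_indicator measurableSet_Ioi]
  refine lintegral_congr fun x => ?_
  rcases le_or_gt x 0 with hx | hx
  · rw [indicator_of_notMem (by simpa using hx)]
    simp [indicator, hx]
  rw [indicator_of_mem (mem_Ioi.2 hx), inv_inv]
  by_cases hxB : x ∈ B
  swap
  · simp [hxB]
  rw [indicator_of_mem hxB, indicator_of_mem hxB, Pi.one_apply, one_mul, if_neg hx.not_ge,
    ← mul_assoc, ← ENNReal.ofReal_inv_of_pos hb, ← ENNReal.ofReal_mul (by positivity),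
    show (α ^ 2)⁻¹ * (1 / x ^ 2) = 1 / (α ^ 2 * x ^ 2) by rw [one_div, one_div, mul_inv]]
  split_ifs with hxb
  · rw [gammaLaw_inv_sub_inv_of_lt ha hx hb hxb, ← ENNReal.ofReal_mul (by positivity)]
  · rw [gammaLaw_inv_sub_inv_of_le ha hx hb (not_lt.1 hxb), ← ENNReal.ofReal_mul (by positivity)]
end

section
/- Let K ≥ 1, α ∈ (0,1), and a₁, …, a_K > 0. Let S₁, …, S_K be independent real random variables with S_k Gamma(2,a_k)-distributed, let Y be uniformly distributed on [0, α²], and let J be uniformly distributed on {1, …, K}, with (S₁,…,S_K), Y, and J mutually independent. Then E[log(1 + (S_J^{-1} + Y)^{-1})] = (1/K)·∑_{k=1}^{K} [ G(a_k/α²) + (1/α²)·G(a_k) - ((α²+1)/α²)·G(a_k/(1+α²)) ]. (This is the ergodic per-user rate of the Random User Selection scheme in multi-user mode with maximum-ratio transmission, with a_k = σ²/g_k.) -/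
open MeasureTheory Real Set
open scoped ENNReal

/-- The uniform law on a finite type (here `Fin K`). -/
noncomputable def unifFin (K : ℕ) : Measure (Fin K) := (K : ℝ≥0∞)⁻¹ • Measure.count

/-- `G(x) = e^x·Ei(-x) = -e^x·∫_x^∞ (e^{-t}/t) dt` for `x > 0`. -/
noncomputable def Gfun (x : ℝ) : ℝ := -(Real.exp x * ∫ t in Set.Ioi x, Real.exp (-t) / t)


open Filter Topology

lemma integrableOn_exp_neg_div {x : ℝ} (hx : 0 < x) :
    IntegrableOn (fun t : ℝ => Real.exp (-t) / t) (Ioi x) := by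
  refine Integrable.mono' ((integrableOn_exp_neg_Ioi x).div_const x) 
    (by fun_prop : Measurable fun t : ℝ => Real.exp (-t) / t).aestronglyMeasurable ?_
  filter_upwards [ae_restrict_mem measurableSet_Ioi] with t ht
  have ht' : x < t := ht
  have : 0 < t := hx.trans ht'
  rw [Real.norm_of_nonneg (by positivity)]
  gcongr

lemma hasDerivAt_integral_exp_neg_div {x : ℝ} (hx : 0 < x) :
    HasDerivAt (fun z : ℝ => ∫ t in Ioi z, Real.exp (-t) / t) (-(Real.exp (-x) / x)) x := by
  have hcont : ∀ y : ℝ, 0 < y → ContinuousAt (fun t : ℝ => Real.exp (-t) / t) y := fun y hy =>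
    ContinuousAt.div (by fun_prop) continuousAt_id hy.ne'
  have hint : IntervalIntegrable (fun t : ℝ => Real.exp (-t) / t) volume (x / 2) x := by
    refine ContinuousOn.intervalIntegrable fun t ht => (hcont t ?_).continuousWithinAt
    rw [uIcc_of_le (by linarith)] at ht
    linarith [ht.1]
  have h := (intervalIntegral.integral_hasDerivAt_right hint
    ((by fun_prop : Measurable fun t : ℝ => Real.exp (-t) / t).stronglyMeasurable
      |>.stronglyMeasurableAtFilter) (hcont x hx)).const_sub
        (∫ t in Ioi (x / 2), Real.exp (-t) / t)
  refine h.congr_of_eventuallyEq ?_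
  filter_upwards [lt_mem_nhds (half_lt_self hx)] with z hz
  rw [← intervalIntegral.integral_Ioi_sub_Ioi (integrableOn_exp_neg_div (half_pos hx)) hz.le]
  ring

lemma hasDerivAt_Gfun {x : ℝ} (hx : 0 < x) : HasDerivAt Gfun (Gfun x + x⁻¹) x := by
  have h := ((Real.hasDerivAt_exp x).mul (hasDerivAt_integral_exp_neg_div hx)).neg
  refine h.congr_deriv ?_
  have : Real.exp x * Real.exp (-x) = 1 := by rw [← Real.exp_add]; simp
  rw [Gfun]
  field_simp
  linear_combination this

lemma abs_Gfun_le {x : ℝ} (hx : 0 < x) : |Gfun x| ≤ x⁻¹ := by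
  have h0 : 0 ≤ ∫ t in Ioi x, Real.exp (-t) / t :=
    setIntegral_nonneg measurableSet_Ioi fun t ht => by
      have : 0 < t := hx.trans ht
      positivity
  have h1 : ∫ t in Ioi x, Real.exp (-t) / t ≤ Real.exp (-x) / x := by
    rw [← integral_exp_neg_Ioi x, ← integral_div]
    refine setIntegral_mono_on (integrableOn_exp_neg_div hx)
      ((integrableOn_exp_neg_Ioi x).div_const x) measurableSet_Ioi fun t ht => ?_
    have ht' : x < t := ht
    gcongr
  rw [Gfun, abs_neg, abs_of_nonneg (by positivity)]
  calc _ ≤ Real.exp x * (Real.exp (-x) / x) := by gcongr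
    _ = x⁻¹ := by rw [← mul_div_assoc, ← Real.exp_add]; simp

lemma tendsto_Gfun_atTop : Tendsto Gfun atTop (𝓝 0) :=
  squeeze_zero_norm' (by
    filter_upwards [eventually_gt_atTop 0] with x hx using abs_Gfun_le hx) tendsto_inv_atTop_zero

/-- An antiderivative in `s` of `a² s e^{-as} log (1 + s y)`. -/
lemma hasDerivAt_gamma_log_antideriv_s4 {a y s : ℝ} (ha : 0 < a) (hy : 0 < y) (hs : 0 ≤ s) :
    HasDerivAt (fun s : ℝ => Real.exp (-(a * s)) *
        ((1 - a / y) * Gfun (a / y + a * s) - 1) -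
          (1 + a * s) * Real.exp (-(a * s)) * Real.log (1 + s * y))
      (a ^ 2 * s * Real.exp (-(a * s)) * Real.log (1 + s * y)) s := by
  have hpos : 0 < 1 + s * y := by positivity
  have hpos' : 0 < a / y + a * s := by positivity
  have hlin : HasDerivAt (fun s : ℝ => a * s) a s := by
    simpa using (hasDerivAt_id s).const_mul a
  have he : HasDerivAt (fun s : ℝ => Real.exp (-(a * s))) (Real.exp (-(a * s)) * -a) s :=
    hlin.neg.exp
  have hG : HasDerivAt (fun s : ℝ => Gfun (a / y + a * s))
      ((Gfun (a / y + a * s) + (a / y + a * s)⁻¹) * a) s :=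
    HasDerivAt.comp (h₂ := Gfun) s (hasDerivAt_Gfun hpos') (hlin.const_add _)
  have hl : HasDerivAt (fun s : ℝ => Real.log (1 + s * y)) (y / (1 + s * y)) s := by
    refine HasDerivAt.log ?_ hpos.ne'
    simpa using ((hasDerivAt_id s).mul_const y).const_add 1
  refine ((he.mul ((hG.const_mul (1 - a / y)).sub_const 1)).sub
    (((hlin.const_add 1).mul he).mul hl)).congr_deriv ?_
  have : (a / y + a * s)⁻¹ = y / (a * (1 + s * y)) := by
    rw [show a / y + a * s = a * (1 + s * y) / y by field_simp, inv_div]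
  rw [this]
  simp only [Pi.mul_apply]
  field_simp
  ring

lemma tendsto_gamma_log_antideriv {a y : ℝ} (ha : 0 < a) (hy : 0 < y) :
    Tendsto (fun s : ℝ => Real.exp (-(a * s)) *
        ((1 - a / y) * Gfun (a / y + a * s) - 1) -
          (1 + a * s) * Real.exp (-(a * s)) * Real.log (1 + s * y)) atTop (𝓝 0) := by
  have hlin : Tendsto (fun s : ℝ => a * s) atTop atTop := tendsto_id.const_mul_atTop ha
  have he : Tendsto (fun s : ℝ => Real.exp (-(a * s))) atTop (𝓝 0) :=
    Real.tendsto_exp_neg_atTop_nhds_zero.comp hlin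
  have hG : Tendsto (fun s : ℝ => Gfun (a / y + a * s)) atTop (𝓝 0) :=
    tendsto_Gfun_atTop.comp (tendsto_atTop_add_const_left _ _ hlin)
  have h1 : Tendsto (fun s : ℝ => a * s * Real.exp (-(a * s))) atTop (𝓝 0) := by
    simpa [Function.comp_def] using (Real.tendsto_pow_mul_exp_neg_atTop_nhds_zero 1).comp hlin
  have h2 : Tendsto (fun s : ℝ => (a * s) ^ 2 * Real.exp (-(a * s))) atTop (𝓝 0) :=
    (Real.tendsto_pow_mul_exp_neg_atTop_nhds_zero 2).comp hlin
  have h3 : Tendsto (fun s : ℝ => (1 + a * s) * Real.exp (-(a * s)) * Real.log (1 + s * y))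
      atTop (𝓝 0) := by
    have hb : Tendsto (fun s : ℝ => (y / a) * (a * s * Real.exp (-(a * s)) +
        (a * s) ^ 2 * Real.exp (-(a * s)))) atTop (𝓝 0) := by
      simpa using (h1.add h2).const_mul (y / a)
    refine squeeze_zero' ?_ ?_ hb
    · filter_upwards [eventually_ge_atTop 0] with s hs
      have : 0 ≤ Real.log (1 + s * y) := Real.log_nonneg (by nlinarith)
      positivity
    · filter_upwards [eventually_ge_atTop 0] with s hs
      have hle : Real.log (1 + s * y) ≤ s * y := by
        have := Real.log_le_sub_one_of_pos (show 0 < 1 + s * y by positivity)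
        linarith
      calc _ ≤ (1 + a * s) * Real.exp (-(a * s)) * (s * y) := by gcongr
        _ = _ := by field_simp
  simpa using (he.mul ((hG.const_mul (1 - a / y)).sub_const 1)).sub h3

lemma gammaLaw_eq_withDensity_restrict (a : ℝ) :
    gammaLaw a = (volume.restrict (Ioi 0)).withDensity
      fun x => ENNReal.ofReal (a ^ 2 * x * Real.exp (-(a * x))) := by
  rw [← withDensity_indicator measurableSet_Ioi, gammaLaw]
  congr 1 with x
  by_cases hx : 0 < x <;> simp [hx]

lemma gammaLaw_eq_gammaMeasure (a : ℝ) :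
    gammaLaw a = ProbabilityTheory.gammaMeasure 2 a := by
  rw [gammaLaw, ProbabilityTheory.gammaMeasure]
  congr 1 with x
  rw [ProbabilityTheory.gammaPDF_eq]
  rcases lt_trichotomy x 0 with hx | rfl | hx
  · simp [hx.not_gt, hx.not_ge]
  · norm_num
  · norm_num [hx, hx.le]

lemma isProbabilityMeasure_gammaLaw {a : ℝ} (ha : 0 < a) : IsProbabilityMeasure (gammaLaw a) := by
  rw [gammaLaw_eq_gammaMeasure]
  exact ProbabilityTheory.isProbabilityMeasure_gammaMeasure two_pos ha

lemma ae_pos_gammaLaw (a : ℝ) : ∀ᵐ s ∂gammaLaw a, 0 < s := by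
  rw [gammaLaw_eq_withDensity_restrict]
  exact (withDensity_absolutelyContinuous _ _).ae_le (ae_restrict_mem measurableSet_Ioi)

lemma gamma_log_density_nonneg {a y s : ℝ} (hy : 0 < y) (hs : 0 ≤ s) :
    0 ≤ a ^ 2 * s * Real.exp (-(a * s)) * Real.log (1 + s * y) := by
  have : 0 ≤ Real.log (1 + s * y) := Real.log_nonneg (by nlinarith)
  positivity

lemma integrable_log_gammaLaw {a y : ℝ} (ha : 0 < a) (hy : 0 < y) :
    Integrable (fun s : ℝ => Real.log (1 + s * y)) (gammaLaw a) := by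
  rw [gammaLaw_eq_withDensity_restrict,
    integrable_withDensity_iff_integrable_smul' (by fun_prop) (by simp)]
  have h := integrableOn_Ioi_deriv_of_nonneg'
    (fun s (hs : s ∈ Ici 0) => hasDerivAt_gamma_log_antideriv_s4 ha hy hs)
    (fun s (hs : s ∈ Ioi 0) => gamma_log_density_nonneg hy (le_of_lt hs))
    (tendsto_gamma_log_antideriv ha hy)
  refine IntegrableOn.congr_fun h (fun s hs => ?_) measurableSet_Ioi
  have hs' : 0 < s := hs
  simp only [smul_eq_mul]
  rw [ENNReal.toReal_ofReal (by positivity)]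

lemma integral_log_gammaLaw {a y : ℝ} (ha : 0 < a) (hy : 0 < y) :
    ∫ s, Real.log (1 + s * y) ∂gammaLaw a = 1 + (a / y - 1) * Gfun (a / y) := by
  rw [gammaLaw_eq_withDensity_restrict,
    integral_withDensity_eq_integral_toReal_smul (by fun_prop) (by simp)]
  have h := integral_Ioi_of_hasDerivAt_of_nonneg'
    (fun s (hs : s ∈ Ici 0) => hasDerivAt_gamma_log_antideriv_s4 ha hy hs)
    (fun s (hs : s ∈ Ioi 0) => gamma_log_density_nonneg hy (le_of_lt hs))
    (tendsto_gamma_log_antideriv ha hy)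
  refine (setIntegral_congr_fun measurableSet_Ioi fun s hs => ?_).trans (h.trans ?_)
  · have hs' : 0 < s := hs
    simp only [smul_eq_mul]
    rw [ENNReal.toReal_ofReal (by positivity)]
  · simp
    ring

lemma hasDerivAt_neg_mul_Gfun_div {a y : ℝ} (ha : 0 < a) (hy : 0 < y) :
    HasDerivAt (fun y : ℝ => -(y * Gfun (a / y))) (1 + (a / y - 1) * Gfun (a / y)) y := by
  have hd : HasDerivAt (fun y : ℝ => a / y) (a * -(y ^ 2)⁻¹) y := by
    simpa [div_eq_mul_inv] using (hasDerivAt_inv hy.ne').const_mul a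
  have hG : HasDerivAt (fun y : ℝ => Gfun (a / y)) _ y :=
    HasDerivAt.comp (h₂ := Gfun) y (hasDerivAt_Gfun (div_pos ha hy)) hd
  refine ((hasDerivAt_id y).mul hG).neg.congr_deriv ?_
  simp only [id]
  field_simp
  ring

lemma continuousOn_neg_mul_Gfun_div {a : ℝ} (ha : 0 < a) :
    ContinuousOn (fun y : ℝ => -(y * Gfun (a / y))) (Ici 0) := by
  intro y hy
  rcases (show 0 ≤ y from hy).eq_or_lt with rfl | hy
  · have hb : Tendsto (fun y : ℝ => y * (y / a)) (𝓝[Ici 0] 0) (𝓝 0) := by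
      have : Continuous fun y : ℝ => y * (y / a) := by fun_prop
      simpa using (this.tendsto 0).mono_left nhdsWithin_le_nhds
    have : Tendsto (fun y : ℝ => -(y * Gfun (a / y))) (𝓝[Ici 0] 0) (𝓝 0) := by
      refine squeeze_zero_norm' ?_ hb
      filter_upwards [self_mem_nhdsWithin] with y hy
      rcases (show 0 ≤ y from hy).eq_or_lt with rfl | hy
      · simp
      · have := abs_Gfun_le (div_pos ha hy)
        rw [inv_div] at this
        rw [norm_neg, norm_mul, Real.norm_of_nonneg hy.le]
        exact mul_le_mul_of_nonneg_left this hy.le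
    simpa [ContinuousWithinAt] using this
  · exact (hasDerivAt_neg_mul_Gfun_div ha hy).continuousAt.continuousWithinAt

lemma one_add_mul_Gfun_div_nonneg {a y : ℝ} (ha : 0 < a) (hy : 0 < y) :
    0 ≤ 1 + (a / y - 1) * Gfun (a / y) := by
  rw [← integral_log_gammaLaw ha hy]
  refine integral_nonneg_of_ae ?_
  filter_upwards [ae_pos_gammaLaw a] with s hs
  exact Real.log_nonneg (by nlinarith)

lemma intervalIntegrable_one_add_mul_Gfun_div {a d e : ℝ} (ha : 0 < a) (hd : 0 ≤ d)
    (hde : d ≤ e) :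
    IntervalIntegrable (fun y : ℝ => 1 + (a / y - 1) * Gfun (a / y)) volume d e := by
  rw [intervalIntegrable_iff_integrableOn_Ioc_of_le hde]
  exact intervalIntegral.integrableOn_deriv_of_nonneg
    ((continuousOn_neg_mul_Gfun_div ha).mono fun y hy => hd.trans hy.1)
    (fun y hy => hasDerivAt_neg_mul_Gfun_div ha (hd.trans_lt hy.1))
    (fun y hy => one_add_mul_Gfun_div_nonneg ha (hd.trans_lt hy.1))

lemma integral_one_add_mul_Gfun_div {a d e : ℝ} (ha : 0 < a) (hd : 0 ≤ d) (hde : d ≤ e) :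
    ∫ y in d..e, (1 + (a / y - 1) * Gfun (a / y)) = d * Gfun (a / d) - e * Gfun (a / e) := by
  rw [intervalIntegral.integral_eq_sub_of_hasDerivAt_of_le hde
    ((continuousOn_neg_mul_Gfun_div ha).mono fun y hy => hd.trans hy.1)
    (fun y hy => hasDerivAt_neg_mul_Gfun_div ha (hd.trans_lt hy.1))
    (intervalIntegrable_one_add_mul_Gfun_div ha hd hde)]
  ring

lemma ae_pos_gammaLaw_prod (a : ℝ) {c d : ℝ} (hd : 0 ≤ d) :
    ∀ᵐ z : ℝ × ℝ ∂(gammaLaw a).prod (volume.restrict (Ioc 0 c)), 0 < z.1 ∧ 0 < d + z.2 := by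
  filter_upwards [Measure.quasiMeasurePreserving_fst.ae (ae_pos_gammaLaw a),
    Measure.quasiMeasurePreserving_snd.ae (ae_restrict_mem (measurableSet_Ioc (a := 0) (b := c)))]
    with z h1 h2
  exact ⟨h1, by linarith [h2.1]⟩

lemma integrableOn_one_add_mul_Gfun_div_add {a c d : ℝ} (ha : 0 < a) (hc : 0 ≤ c) (hd : 0 ≤ d) :
    IntegrableOn (fun y : ℝ => 1 + (a / (d + y) - 1) * Gfun (a / (d + y))) (Ioc 0 c) := by
  rw [← intervalIntegrable_iff_integrableOn_Ioc_of_le hc]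
  have h := (intervalIntegrable_one_add_mul_Gfun_div ha hd (le_add_of_nonneg_right hc)).comp_add_left
    (c := d)
  simpa using h

lemma integrable_log_gammaLaw_prod {a c d : ℝ} (ha : 0 < a) (hc : 0 ≤ c) (hd : 0 ≤ d) :
    Integrable (fun z : ℝ × ℝ => Real.log (1 + z.1 * (d + z.2)))
      ((gammaLaw a).prod (volume.restrict (Ioc 0 c))) := by
  have := isProbabilityMeasure_gammaLaw ha
  rw [integrable_prod_iff' (by
    exact (by fun_prop : Measurable fun z : ℝ × ℝ =>
      Real.log (1 + z.1 * (d + z.2))).aestronglyMeasurable)]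
  refine ⟨?_, (integrableOn_one_add_mul_Gfun_div_add ha hc hd).congr ?_⟩
  · filter_upwards [ae_restrict_mem measurableSet_Ioc] with y hy
    exact integrable_log_gammaLaw ha (by linarith [hy.1])
  · filter_upwards [ae_restrict_mem measurableSet_Ioc] with y hy
    have hy' : 0 < d + y := by linarith [hy.1]
    rw [← integral_log_gammaLaw ha hy']
    refine integral_congr_ae ?_
    filter_upwards [ae_pos_gammaLaw a] with s hs
    exact (Real.norm_of_nonneg (Real.log_nonneg (by nlinarith))).symm

lemma integral_log_gammaLaw_prod {a c d : ℝ} (ha : 0 < a) (hc : 0 ≤ c) (hd : 0 ≤ d) :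
    ∫ z : ℝ × ℝ, Real.log (1 + z.1 * (d + z.2)) ∂(gammaLaw a).prod (volume.restrict (Ioc 0 c))
      = d * Gfun (a / d) - (d + c) * Gfun (a / (d + c)) := by
  have := isProbabilityMeasure_gammaLaw ha
  rw [integral_prod_symm _ (integrable_log_gammaLaw_prod ha hc hd),
    ← integral_one_add_mul_Gfun_div ha hd (le_add_of_nonneg_right hc)]
  have h := intervalIntegral.integral_comp_add_left (a := 0) (b := c)
    (fun y : ℝ => 1 + (a / y - 1) * Gfun (a / y)) d
  rw [add_zero] at h
  rw [← h, intervalIntegral.integral_of_le hc]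
  refine setIntegral_congr_fun measurableSet_Ioc fun y hy => ?_
  have hy' : 0 < d + y := by linarith [hy.1]
  exact integral_log_gammaLaw ha hy'

lemma log_one_add_inv_add_inv {s y : ℝ} (hs : 0 < s) (hy : 0 ≤ y) :
    Real.log (1 + (s⁻¹ + y)⁻¹) = Real.log (1 + s * (1 + y)) - Real.log (1 + s * y) := by
  rw [← Real.log_div (by positivity) (by positivity)]
  congr 1
  field_simp
  ring

lemma ae_rate_eq (a c : ℝ) :
    (fun z : ℝ × ℝ => Real.log (1 + z.1 * (1 + z.2)) - Real.log (1 + z.1 * (0 + z.2)))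
      =ᵐ[(gammaLaw a).prod (volume.restrict (Ioc 0 c))]
        fun z => Real.log (1 + (z.1⁻¹ + z.2)⁻¹) := by
  filter_upwards [ae_pos_gammaLaw_prod a le_rfl] with z hz
  rw [zero_add] at hz ⊢
  exact (log_one_add_inv_add_inv hz.1 hz.2.le).symm

lemma unifLaw_zero_eq (c : ℝ) :
    unifLaw 0 c = (ENNReal.ofReal c)⁻¹ • volume.restrict (Ioc 0 c) := by
  rw [unifLaw, sub_zero, Measure.restrict_congr_set Ioc_ae_eq_Icc]

lemma integrable_rate {a c : ℝ} (ha : 0 < a) (hc : 0 < c) :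
    Integrable (fun z : ℝ × ℝ => Real.log (1 + (z.1⁻¹ + z.2)⁻¹))
      ((gammaLaw a).prod (unifLaw 0 c)) := by
  rw [unifLaw_zero_eq, Measure.prod_smul_right]
  refine Integrable.smul_measure (((integrable_log_gammaLaw_prod ha hc.le zero_le_one).sub
    (integrable_log_gammaLaw_prod ha hc.le le_rfl)).congr (ae_rate_eq a c)) ?_
  simpa using hc

lemma integral_rate {a c : ℝ} (ha : 0 < a) (hc : 0 < c) :
    ∫ z : ℝ × ℝ, Real.log (1 + (z.1⁻¹ + z.2)⁻¹) ∂(gammaLaw a).prod (unifLaw 0 c)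
      = Gfun (a / c) + (1 / c) * Gfun a - ((c + 1) / c) * Gfun (a / (1 + c)) := by
  rw [unifLaw_zero_eq, Measure.prod_smul_right, integral_smul_measure,
    ← integral_congr_ae (ae_rate_eq a c),
    integral_sub (integrable_log_gammaLaw_prod ha hc.le zero_le_one)
      (integrable_log_gammaLaw_prod ha hc.le le_rfl),
    integral_log_gammaLaw_prod ha hc.le zero_le_one, integral_log_gammaLaw_prod ha hc.le le_rfl,
    ENNReal.toReal_inv, ENNReal.toReal_ofReal hc.le]
  simp only [div_one, zero_add, zero_mul, one_mul, smul_eq_mul]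
  field_simp
  ring

instance (K : ℕ) : SFinite (unifFin K) := by
  unfold unifFin
  infer_instance

instance (c : ℝ) : SFinite (unifLaw 0 c) := by
  unfold unifLaw
  infer_instance

lemma isFiniteMeasure_unifFin {K : ℕ} (hK : 1 ≤ K) : IsFiniteMeasure (unifFin K) :=
  Measure.smul_finite _ (by simp; omega)

lemma integral_indicator_unifFin {K : ℕ} (k : Fin K) :
    ∫ j, (if j = k then (1 : ℝ) else 0) ∂unifFin K = 1 / (K : ℝ) := by
  rw [unifFin, integral_smul_measure, integral_count]
  simp

/-- Ergodic per-user rate of the RUS scheme in multi-user mode with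
maximum-ratio transmission: `S₁, …, S_K` independent with `S_k ~ Gamma(2, a_k)`,
`Y ~ Uniform[0, α²]`, `J` uniform on `{1, …, K}`, all mutually independent (the joint
law is the product of the marginals). Then
`E[log(1 + (S_J⁻¹ + Y)⁻¹)] = (1/K)·∑_k [G(a_k/α²) + (1/α²)G(a_k) - ((α²+1)/α²)G(a_k/(1+α²))]`. -/
theorem rus_mu_mode_mrt_ergodic_rate {Ω : Type*} [MeasurableSpace Ω]
    (μ : Measure Ω) [IsProbabilityMeasure μ]
    (K : ℕ) (hK : 1 ≤ K) (α : ℝ) (hα : α ∈ Set.Ioo (0 : ℝ) 1)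
    (a : Fin K → ℝ) (ha : ∀ k, 0 < a k)
    (S : Fin K → Ω → ℝ) (Y : Ω → ℝ) (J : Ω → Fin K)
    (hSmeas : ∀ k, Measurable (S k)) (hYmeas : Measurable Y) (hJmeas : Measurable J)
    (hlaw : Measure.map
        (fun ω => ((fun k => S k ω, Y ω, J ω) : (Fin K → ℝ) × ℝ × Fin K)) μ
      = (Measure.pi fun k => gammaLaw (a k)).prod
          ((unifLaw 0 (α ^ 2)).prod (unifFin K))) :
    ∫ ω, Real.log (1 + ((S (J ω) ω)⁻¹ + Y ω)⁻¹) ∂μ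
      = (1 / (K : ℝ)) * ∑ k : Fin K,
          (Gfun (a k / α ^ 2) + (1 / α ^ 2) * Gfun (a k)
            - ((α ^ 2 + 1) / α ^ 2) * Gfun (a k / (1 + α ^ 2))) := by
  have hc : 0 < α ^ 2 := pow_pos hα.1 2
  have := fun k => isProbabilityMeasure_gammaLaw (ha k)
  have := isFiniteMeasure_unifFin hK
  have hP : ∀ k, MeasurePreserving (fun ω => ((S k ω, Y ω), J ω)) μ
      (((gammaLaw (a k)).prod (unifLaw 0 (α ^ 2))).prod (unifFin K)) := fun k =>
    (MeasurePreserving.symm MeasurableEquiv.prodAssoc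
      ⟨MeasurableEquiv.prodAssoc.measurable, Measure.prodAssoc_prod⟩).comp
      (((measurePreserving_eval (fun k => gammaLaw (a k)) k).prod
        (MeasurePreserving.id ((unifLaw 0 (α ^ 2)).prod (unifFin K)))).comp
        (⟨by fun_prop, hlaw⟩ : MeasurePreserving _ μ _))
  have hind : ∀ k : Fin K, Integrable (fun j => if j = k then (1 : ℝ) else 0) (unifFin K) :=
    fun k => Integrable.of_finite
  have hint : ∀ k, Integrable (fun z : (ℝ × ℝ) × Fin K =>
      Real.log (1 + (z.1.1⁻¹ + z.1.2)⁻¹) * if z.2 = k then (1 : ℝ) else 0)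
      (((gammaLaw (a k)).prod (unifLaw 0 (α ^ 2))).prod (unifFin K)) := fun k =>
    (integrable_rate (ha k) hc).mul_prod (hind k)
  have hsum : ∀ ω, Real.log (1 + ((S (J ω) ω)⁻¹ + Y ω)⁻¹) =
      ∑ k, Real.log (1 + ((S k ω)⁻¹ + Y ω)⁻¹) * if J ω = k then (1 : ℝ) else 0 := fun ω => by
    simp
  simp_rw [hsum]
  have hintΩ : ∀ k, Integrable (fun ω => Real.log (1 + ((S k ω)⁻¹ + Y ω)⁻¹) *
      if J ω = k then (1 : ℝ) else 0) μ := fun k =>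
    (hP k).integrable_comp_of_integrable (hint k)
  rw [integral_finsetSum _ fun k _ => hintΩ k, Finset.mul_sum]
  refine Finset.sum_congr rfl fun k _ => ?_
  have hmap := integral_map (hP k).measurable.aemeasurable
    ((hP k).map_eq.symm ▸ (hint k).aestronglyMeasurable)
  rw [(hP k).map_eq] at hmap
  rw [← hmap, integral_prod_mul (fun z : ℝ × ℝ => Real.log (1 + (z.1⁻¹ + z.2)⁻¹))
    (fun j => if j = k then (1 : ℝ) else 0), integral_rate (ha k) hc,
    integral_indicator_unifFin, mul_comm]
end

section
/- Let a > 0 and α ∈ (0,1). Let S be Gamma(2,a)-distributed and Y be uniformly distributed on [1-α², 1], with S and Y independent. Then the product S·Y has a law with density f(x) = (a/α²)·[e^{-a·x} - e^{-a·x/(1-α²)}] for x > 0. -/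
open MeasureTheory Real Set
open scoped ENNReal

/-- Scaling the Lebesgue variable by `y ≠ 0` in an integral against a density. -/
lemma lintegral_mul_comp_mul_right {y : ℝ} (hy : y ≠ 0) {p g : ℝ → ℝ≥0∞}
    (hp : Measurable p) (hg : Measurable g) :
    ∫⁻ s, p s * g (s * y) = ∫⁻ x, ENNReal.ofReal |y⁻¹| * p (x / y) * g x := by
  have hm : Measurable fun x => ENNReal.ofReal |y⁻¹| * p (x / y) * g x := by fun_prop
  have hc : ENNReal.ofReal |y| * ENNReal.ofReal |y⁻¹| = 1 := by
    rw [← ENNReal.ofReal_mul (abs_nonneg y), ← abs_mul, mul_inv_cancel₀ hy]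
    simp
  conv_rhs => rw [← Real.smul_map_volume_mul_right hy]
  rw [lintegral_smul_measure, lintegral_map hm (by fun_prop), smul_eq_mul,
    ← lintegral_const_mul _ (by fun_prop)]
  refine lintegral_congr fun s => ?_
  rw [mul_div_cancel_right₀ s hy, ← mul_assoc, ← mul_assoc, hc, one_mul]

/-- The density of the product of two independent real random variables, the first of which has a
density and the second of which is almost surely nonzero. -/
lemma map_mul_eq_withDensity_of_indepFun {Ω : Type*} [MeasurableSpace Ω] {μ : Measure Ω}
    [IsFiniteMeasure μ] {S Y : Ω → ℝ} (hS : Measurable S) (hY : Measurable Y)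
    {p : ℝ → ℝ≥0∞} (hp : Measurable p) (hSlaw : μ.map S = volume.withDensity p)
    (hY0 : ∀ᵐ y ∂(μ.map Y), y ≠ 0) (hindep : ProbabilityTheory.IndepFun S Y μ) :
    μ.map (fun ω => S ω * Y ω) = volume.withDensity fun x =>
      ∫⁻ y, ENNReal.ofReal |y⁻¹| * p (x / y) ∂(μ.map Y) := by
  have hprod := (ProbabilityTheory.indepFun_iff_map_prod_eq_prod_map_map
    hS.aemeasurable hY.aemeasurable).mp hindep
  have hmul : μ.map (fun ω => S ω * Y ω)
      = ((μ.map S).prod (μ.map Y)).map fun z : ℝ × ℝ => z.1 * z.2 := by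
    rw [← hprod, Measure.map_map (by fun_prop) (by fun_prop)]
    rfl
  ext A hA
  have hg : Measurable (A.indicator (1 : ℝ → ℝ≥0∞)) := measurable_one.indicator hA
  have hmeas : Measurable fun z : ℝ × ℝ =>
      ENNReal.ofReal |z.2⁻¹| * p (z.1 / z.2) * A.indicator 1 z.1 := by fun_prop
  calc μ.map (fun ω => S ω * Y ω) A
      = ∫⁻ x, A.indicator 1 x ∂(μ.map fun ω => S ω * Y ω) := (lintegral_indicator_one hA).symm
    _ = ∫⁻ z, A.indicator 1 (z.1 * z.2) ∂((μ.map S).prod (μ.map Y)) := by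
        rw [hmul, lintegral_map hg (by fun_prop)]
    _ = ∫⁻ y, ∫⁻ s, A.indicator 1 (s * y) ∂(μ.map S) ∂(μ.map Y) :=
        lintegral_prod_symm' _ (by fun_prop)
    _ = ∫⁻ y, ∫⁻ x, ENNReal.ofReal |y⁻¹| * p (x / y) * A.indicator 1 x ∂volume ∂(μ.map Y) := by
        refine lintegral_congr_ae (hY0.mono fun y hy => ?_)
        simp only
        rw [hSlaw, lintegral_withDensity_eq_lintegral_mul _ hp (by fun_prop),
          ← lintegral_mul_comp_mul_right hy hp hg]
        rfl
    _ = ∫⁻ x, ∫⁻ y, ENNReal.ofReal |y⁻¹| * p (x / y) * A.indicator 1 x ∂(μ.map Y) :=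
        lintegral_lintegral_swap (hmeas.comp measurable_swap).aemeasurable
    _ = ∫⁻ x, A.indicator
          (fun x => ∫⁻ y, ENNReal.ofReal |y⁻¹| * p (x / y) ∂(μ.map Y)) x := by
        refine lintegral_congr fun x => ?_
        by_cases hx : x ∈ A <;> simp [hx]
    _ = _ := by rw [lintegral_indicator hA, withDensity_apply _ hA]

/-- The mixture of `exp (-(c / y))` against `y⁻²` over an interval. -/
lemma integral_mul_exp_neg_div {lo hi : ℝ} (hlo : 0 < lo) (h : lo ≤ hi) (b c : ℝ) :
    ∫ y in lo..hi, b * (c / y ^ 2 * exp (-(c / y))) =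
      b * (exp (-(c / hi)) - exp (-(c / lo))) := by
  have hpos : ∀ y ∈ uIcc lo hi, y ≠ 0 := fun y hy => by
    rw [uIcc_of_le h] at hy
    exact (hlo.trans_le hy.1).ne'
  rw [intervalIntegral.integral_const_mul, intervalIntegral.integral_eq_sub_of_hasDerivAt
    (f := fun y => exp (-(c / y)))]
  · intro y hy
    have hd := (((hasDerivAt_inv (hpos y hy)).const_mul c).neg).exp
    simp only [Pi.neg_apply, ← div_eq_mul_inv] at hd
    exact hd.congr_deriv (by ring)
  · refine ContinuousOn.intervalIntegrable fun y hy => ContinuousAt.continuousWithinAt ?_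
    have := hpos y hy
    fun_prop (disch := simpa using this)

/-- SINR density under zero-forcing beamforming: if `S ~ Gamma(2,a)`
and `Y ~ Uniform[1-α², 1]` are independent, then `S·Y` has law with density
`(a/α²)·[e^{-a·x} - e^{-a·x/(1-α²)}]` for `x > 0` (and `0` for `x ≤ 0`, since
`S·Y > 0` a.s.). -/
theorem zf_sinr_density {Ω : Type*} [MeasurableSpace Ω]
    (μ : Measure Ω) [IsProbabilityMeasure μ]
    (a α : ℝ) (ha : 0 < a) (hα : α ∈ Set.Ioo (0 : ℝ) 1)
    (S Y : Ω → ℝ) (hS : Measurable S) (hY : Measurable Y)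
    (hSlaw : Measure.map S μ = gammaLaw a)
    (hYlaw : Measure.map Y μ = unifLaw (1 - α ^ 2) 1)
    (hindep : ProbabilityTheory.IndepFun S Y μ) :
    Measure.map (fun ω => S ω * Y ω) μ
      = volume.withDensity fun x => ENNReal.ofReal (
          if 0 < x then
            (a / α ^ 2) * (Real.exp (-(a * x)) - Real.exp (-(a * x / (1 - α ^ 2))))
          else 0) := by
  obtain ⟨hα0, hα1⟩ := hα
  have hα2 : 0 < α ^ 2 := by positivity
  have hlo : 0 < 1 - α ^ 2 := by nlinarith
  have hle : 1 - α ^ 2 ≤ 1 := by linarith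
  have hp : Measurable fun x : ℝ =>
      ENNReal.ofReal (if 0 < x then a ^ 2 * x * exp (-(a * x)) else 0) :=
    (Measurable.ite measurableSet_Ioi (by fun_prop) measurable_const).ennreal_ofReal
  have hY0 : ∀ᵐ y ∂(μ.map Y), y ≠ 0 := by
    rw [hYlaw]
    refine Measure.ae_smul_measure ?_ _
    filter_upwards [ae_restrict_mem measurableSet_Icc] with y hy
    exact (hlo.trans_le hy.1).ne'
  rw [map_mul_eq_withDensity_of_indepFun hS hY hp hSlaw hY0 hindep, hYlaw]
  congr 1
  ext x
  rw [unifLaw, lintegral_smul_measure, sub_sub_cancel, ← ENNReal.ofReal_inv_of_pos hα2,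
    smul_eq_mul]
  split_ifs with hx
  · have hcongr : ∫⁻ y in Icc (1 - α ^ 2) 1, ENNReal.ofReal |y⁻¹| *
        ENNReal.ofReal (if 0 < x / y then a ^ 2 * (x / y) * exp (-(a * (x / y))) else 0)
        = ∫⁻ y in Icc (1 - α ^ 2) 1,
          ENNReal.ofReal (a * (a * x / y ^ 2 * exp (-(a * x / y)))) := by
      refine setLIntegral_congr_fun measurableSet_Icc fun y hy => ?_
      have hy0 : 0 < y := hlo.trans_le hy.1
      rw [if_pos (div_pos hx hy0), abs_of_pos (inv_pos.mpr hy0),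
        ← ENNReal.ofReal_mul (inv_pos.mpr hy0).le, ← mul_div_assoc a x y]
      congr 1
      field_simp
    have hint : IntegrableOn (fun y => a * (a * x / y ^ 2 * exp (-(a * x / y))))
        (Icc (1 - α ^ 2) 1) := by
      refine ContinuousOn.integrableOn_Icc fun y hy => ContinuousAt.continuousWithinAt ?_
      have hy0 : y ≠ 0 := (hlo.trans_le hy.1).ne'
      fun_prop (disch := simpa using hy0)
    rw [hcongr, ← ofReal_integral_eq_lintegral_ofReal hint
      (.of_forall fun y => by dsimp; positivity), integral_Icc_eq_integral_Ioc,
      ← intervalIntegral.integral_of_le hle, integral_mul_exp_neg_div hlo hle,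
      ← ENNReal.ofReal_mul (inv_pos.mpr hα2).le, div_one]
    congr 1
    ring
  · rw [setLIntegral_congr_fun measurableSet_Icc (g := fun _ => 0) fun y hy => ?_]
    · simp
    · have hy0 : 0 < y := hlo.trans_le hy.1
      have : ¬ 0 < x / y := by
        rw [not_lt] at hx ⊢
        exact div_nonpos_of_nonpos_of_nonneg hx hy0.le
      simp [this]
end

section
/- Let K ≥ 1 and a₁, …, a_K > 0, and let S₁, …, S_K be independent real random variables with S_k Gamma(2,a_k)-distributed. Then E[log(1 + max_{1≤k≤K} S_k)] = ∫₀^∞ ( 1 - ∏_{k=1}^{K} [ 1 - ((e^{x}-1)·a_k + 1)·e^{-(e^{x}-1)·a_k} ] ) dx. (This is the ergodic rate of the Max-Gain User Selection scheme in single-user mode, with a_k = σ̃²/g_k.) -/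
open MeasureTheory Real Set
open scoped ENNReal

theorem hasDerivAt_gammaLaw_cdf (a x : ℝ) :
    HasDerivAt (fun x => 1 - (x * a + 1) * Real.exp (-(x * a)))
      (a ^ 2 * x * Real.exp (-(a * x))) x := by
  have h : HasDerivAt (fun x : ℝ => x * a) a x := by
    simpa using (hasDerivAt_id x).mul_const a
  have h' := ((h.add_const 1).mul h.neg.exp).const_sub 1
  refine h'.congr_deriv ?_
  simp only [Pi.neg_apply, mul_comm a x]
  ring

theorem gammaLaw_Iic (a : ℝ) {t : ℝ} (ht : 0 ≤ t) :
    gammaLaw a (Iic t) = ENNReal.ofReal (1 - (t * a + 1) * Real.exp (-(t * a))) := by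
  have hind : ∀ x : ℝ,
      ENNReal.ofReal (if 0 < x then a ^ 2 * x * Real.exp (-(a * x)) else 0)
        = (Ioi (0 : ℝ)).indicator
            (fun x => ENNReal.ofReal (a ^ 2 * x * Real.exp (-(a * x)))) x := by
    intro x
    by_cases hx : 0 < x <;> simp [hx]
  have hcont : Continuous fun x : ℝ => a ^ 2 * x * Real.exp (-(a * x)) := by fun_prop
  rw [gammaLaw, withDensity_apply _ measurableSet_Iic, lintegral_congr hind,
    lintegral_indicator measurableSet_Ioi, Measure.restrict_restrict measurableSet_Ioi,
    Ioi_inter_Iic, ← ofReal_integral_eq_lintegral_ofReal,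
    ← intervalIntegral.integral_of_le ht,
    intervalIntegral.integral_eq_sub_of_hasDerivAt
      (fun x _ => hasDerivAt_gammaLaw_cdf a x) (hcont.intervalIntegrable 0 t)]
  · simp
  · exact (hcont.intervalIntegrable 0 t).1
  · filter_upwards [ae_restrict_mem measurableSet_Ioc] with x hx
    have := hx.1.le
    simp only [Pi.zero_apply]
    positivity

theorem one_sub_add_one_mul_exp_neg_mem_Icc {z : ℝ} (hz : 0 ≤ z) :
    1 - (z + 1) * Real.exp (-z) ∈ Icc (0 : ℝ) 1 := by
  have h : (z + 1) * Real.exp (-z) ≤ Real.exp z * Real.exp (-z) := by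
    gcongr
    exact Real.add_one_le_exp z
  rw [← Real.exp_add, add_neg_cancel, Real.exp_zero] at h
  have h' : 0 ≤ (z + 1) * Real.exp (-z) := by positivity
  constructor <;> linarith

theorem sigmaFinite_gammaLaw (a : ℝ) : SigmaFinite (gammaLaw a) := by
  unfold gammaLaw
  infer_instance

/-- The CDF of the maximum of independent `Gamma(2, a_k)` variables. -/
theorem measure_iSup_le_of_map_eq_pi_gammaLaw {Ω ι : Type*} [MeasurableSpace Ω] [Fintype ι]
    [Nonempty ι] {μ : Measure Ω} {a : ι → ℝ} (ha : ∀ k, 0 < a k) {S : ι → Ω → ℝ}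
    (hS : ∀ k, Measurable (S k))
    (hlaw : Measure.map (fun ω k => S k ω) μ = Measure.pi fun k => gammaLaw (a k))
    {t : ℝ} (ht : 0 ≤ t) :
    μ {ω | ⨆ k, S k ω ≤ t}
      = ENNReal.ofReal (∏ k, (1 - (t * a k + 1) * Real.exp (-(t * a k)))) := by
  have := fun k => sigmaFinite_gammaLaw (a k)
  have hset : {ω | ⨆ k, S k ω ≤ t} = (fun ω k => S k ω) ⁻¹' univ.pi fun _ => Iic t := by
    ext ω
    simp [ciSup_le_iff (finite_range fun k => S k ω).bddAbove, Pi.le_def]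
  rw [hset, ← Measure.map_apply (measurable_pi_lambda _ hS)
    (MeasurableSet.univ_pi fun _ => measurableSet_Iic), hlaw, Measure.pi_pi,
    ENNReal.ofReal_prod_of_nonneg fun k _ =>
      (one_sub_add_one_mul_exp_neg_mem_Icc (mul_nonneg ht (ha k).le)).1]
  exact Finset.prod_congr rfl fun k _ => gammaLaw_Iic (a k) ht

/-- Ergodic rate of the MUS scheme in single-user mode:
`S₁, …, S_K` independent with `S_k ~ Gamma(2, a_k)` (joint law the product measure).
Then `E[log(1 + max_k S_k)]
  = ∫₀^∞ (1 - ∏_k [1 - ((eˣ-1)·a_k + 1)·e^{-(eˣ-1)·a_k}]) dx`. -/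
theorem mus_su_mode_ergodic_rate {Ω : Type*} [MeasurableSpace Ω]
    (μ : Measure Ω) [IsProbabilityMeasure μ]
    (K : ℕ) (hK : 1 ≤ K) (a : Fin K → ℝ) (ha : ∀ k, 0 < a k)
    (S : Fin K → Ω → ℝ) (hSmeas : ∀ k, Measurable (S k))
    (hlaw : Measure.map (fun ω => (fun k => S k ω)) μ = Measure.pi fun k => gammaLaw (a k)) :
    ∫ ω, Real.log (1 + ⨆ k, S k ω) ∂μ
      = ∫ x in Set.Ioi (0 : ℝ),
          (1 - ∏ k : Fin K,
            (1 - ((Real.exp x - 1) * a k + 1) * Real.exp (-((Real.exp x - 1) * a k)))) := by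
  have : Nonempty (Fin K) := ⟨⟨0, hK⟩⟩
  have hsup : Measurable fun ω => ⨆ k, S k ω := Measurable.iSup hSmeas
  have hlog : Measurable fun ω => Real.log (1 + ⨆ k, S k ω) := by fun_prop
  have hpos : ∀ᵐ ω ∂μ, 0 < ⨆ k, S k ω := by
    rw [ae_iff]
    simp only [not_lt]
    rw [measure_iSup_le_of_map_eq_pi_gammaLaw ha hSmeas hlaw le_rfl]
    simp [Nat.one_le_iff_ne_zero.mp hK]
  have hlog_nonneg : 0 ≤ᵐ[μ] fun ω => Real.log (1 + ⨆ k, S k ω) := by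
    filter_upwards [hpos] with ω hω
    exact Real.log_nonneg (by linarith)
  have hexp : ∀ {x : ℝ}, x ∈ Ioi (0 : ℝ) → 0 ≤ Real.exp x - 1 := fun hx =>
    sub_nonneg.mpr (Real.one_le_exp (le_of_lt hx))
  have hfactor : ∀ {x : ℝ}, x ∈ Ioi (0 : ℝ) → ∀ k,
      1 - ((Real.exp x - 1) * a k + 1) * Real.exp (-((Real.exp x - 1) * a k)) ∈ Icc (0 : ℝ) 1 :=
    fun hx k => one_sub_add_one_mul_exp_neg_mem_Icc (mul_nonneg (hexp hx) (ha k).le)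
  rw [integral_eq_lintegral_of_nonneg_ae hlog_nonneg hlog.aestronglyMeasurable,
    integral_eq_lintegral_of_nonneg_ae,
    lintegral_eq_lintegral_meas_lt μ hlog_nonneg hlog.aemeasurable]
  · congr 1
    refine setLIntegral_congr_fun measurableSet_Ioi fun x hx => ?_
    have htail : {ω | x < Real.log (1 + ⨆ k, S k ω)}
        =ᵐ[μ] ({ω | ⨆ k, S k ω ≤ Real.exp x - 1}ᶜ : Set Ω) := by
      filter_upwards [hpos] with ω hω
      apply propext
      change x < Real.log (1 + ⨆ k, S k ω) ↔ ¬ (⨆ k, S k ω ≤ Real.exp x - 1)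
      rw [Real.lt_log_iff_exp_lt (by linarith), not_le, sub_lt_iff_lt_add']
    rw [measure_congr htail, prob_compl_eq_one_sub (measurableSet_le hsup measurable_const),
      measure_iSup_le_of_map_eq_pi_gammaLaw ha hSmeas hlaw (hexp hx),
      ENNReal.ofReal_sub _ (Finset.prod_nonneg fun k _ => (hfactor hx k).1), ENNReal.ofReal_one]
  · filter_upwards [ae_restrict_mem measurableSet_Ioi] with x hx
    exact sub_nonneg.mpr
      (Finset.prod_le_one (fun k _ => (hfactor hx k).1) fun k _ => (hfactor hx k).2)
  · exact Continuous.aestronglyMeasurable (by fun_prop)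
end

section
/- For every x > 0 and every α ∈ (0,1], ∫₀^{α²} log(1 + (x^{-1} + y)^{-1}) dy = log((1 + x + α²·x)/(1 + x)) + (1/x)·log((1 + (x^{-1} + α²)^{-1})/(1 + x)) + α²·log(1 + (x^{-1} + α²)^{-1}). -/
open MeasureTheory Real Set

lemma log_one_add_inv_eq_sub {t : ℝ} (ht : 0 < t) : log (1 + t⁻¹) = log (t + 1) - log t := by
  rw [← log_div (by positivity) ht.ne']
  congr 1
  field_simp

lemma hasDerivAt_add_mul_log_add (c : ℝ) {y : ℝ} (h : c + y ≠ 0) :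
    HasDerivAt (fun y => (c + y) * log (c + y)) (log (c + y) + 1) y := by
  simpa using (hasDerivAt_mul_log h).comp_const_add c y

lemma integral_log_one_add_inv_add {c b : ℝ} (hc : 0 < c) (hb : 0 ≤ b) :
    ∫ y in (0 : ℝ)..b, log (1 + (c + y)⁻¹) =
      (c + 1 + b) * log (c + 1 + b) - (c + b) * log (c + b)
        - ((c + 1) * log (c + 1) - c * log c) := by
  have hpos : ∀ y ∈ uIcc 0 b, 0 < c + y := fun y hy => by
    rw [uIcc_of_le hb] at hy
    linarith [hy.1]
  have hderiv : ∀ y ∈ uIcc 0 b,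
      HasDerivAt (fun y => (c + 1 + y) * log (c + 1 + y) - (c + y) * log (c + y))
        (log (1 + (c + y)⁻¹)) y := fun y hy => by
    have h := hpos y hy
    refine ((hasDerivAt_add_mul_log_add (c + 1) (y := y) (by linarith)).sub
      (hasDerivAt_add_mul_log_add c h.ne')).congr_deriv ?_
    rw [log_one_add_inv_eq_sub h, add_right_comm c y 1]
    ring
  have hcont : ContinuousOn (fun y => log (1 + (c + y)⁻¹)) (uIcc 0 b) := by
    refine ContinuousOn.log (continuousOn_const.add
      (ContinuousOn.inv₀ (by fun_prop) fun y hy => (hpos y hy).ne')) fun y hy => ?_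
    have := hpos y hy
    positivity
  rw [intervalIntegral.integral_eq_sub_of_hasDerivAt hderiv hcont.intervalIntegrable]
  simp only [add_zero]

/-- For every `x > 0` and `α ∈ (0,1]`,
`∫₀^{α²} log(1 + (x⁻¹ + y)⁻¹) dy = log((1+x+α²x)/(1+x))
  + (1/x)·log((1+(x⁻¹+α²)⁻¹)/(1+x)) + α²·log(1+(x⁻¹+α²)⁻¹)`,
i.e. the inner MRT integral equals `Υ^{MRT}(x)`. -/
theorem integral_log_mrt_inner (x α : ℝ) (hx : 0 < x) (hα : α ∈ Set.Ioc (0 : ℝ) 1) :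
    ∫ y in Set.Icc (0 : ℝ) (α ^ 2), Real.log (1 + (x⁻¹ + y)⁻¹)
      = Real.log ((1 + x + α ^ 2 * x) / (1 + x))
        + (1 / x) * Real.log ((1 + (x⁻¹ + α ^ 2)⁻¹) / (1 + x))
        + α ^ 2 * Real.log (1 + (x⁻¹ + α ^ 2)⁻¹) := by
  have hc : 0 < x⁻¹ := inv_pos.mpr hx
  have hb : 0 ≤ α ^ 2 := sq_nonneg α
  rw [integral_Icc_eq_integral_Ioc, ← intervalIntegral.integral_of_le hb,
    integral_log_one_add_inv_add hc hb]
  have hfirst : log ((1 + x + α ^ 2 * x) / (1 + x)) = log (x⁻¹ + 1 + α ^ 2) - log (x⁻¹ + 1) := by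
    rw [← log_div (by positivity) (by positivity)]
    congr 1
    field_simp
  have hx1 : log (1 + x) = log (x⁻¹ + 1) - log x⁻¹ := by
    simpa using log_one_add_inv_eq_sub hc
  rw [hfirst, log_div (by positivity) (by positivity), hx1,
    log_one_add_inv_eq_sub (by positivity : 0 < x⁻¹ + α ^ 2), add_right_comm x⁻¹ (α ^ 2) 1]
  ring
end
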